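/- Let σ, μ₀, c > 0, let Ω ⊆ ℝ² be open, and let U = (U₁,U₂), B = (B₁,B₂) : (0,T)×Ω → ℝ² and E, J : (0,T)×Ω → ℝ be C² functions satisfying: Faraday's law ∂_tB₁ + ∂_yE = 0 and ∂_tB₂ − ∂ₓE = 0; Ohm's law J = σ(E + U₁B₂ − U₂B₁); Ampère's law (1/c²)∂_tE + μ₀J = ∂ₓB₂ − ∂_yB₁; and the divergence-free conditions ∂ₓU₁ + ∂_yU₂ = 0 and ∂ₓB₁ + ∂_yB₂ = 0. Then B satisfies the hyperbolic induction equation: for i = 1,2, (1/(σμ₀c²))∂²_tB_i + ∂_tB_i − (1/(σμ₀))(∂²ₓ + ∂²_y)B_i = B₁∂ₓU_i + B₂∂_yU_i − U₁∂ₓB_i − U₂∂_yB_i on (0,T)×Ω. -/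

import Mathlib

/-- Partial derivative in time of a function of (t, x, y). -/
noncomputable def dT (f : ℝ → ℝ → ℝ → ℝ) (t x y : ℝ) : ℝ := deriv (fun s => f s x y) t

/-- Partial derivative in the horizontal variable of a function of (t, x, y). -/
noncomputable def dX (f : ℝ → ℝ → ℝ → ℝ) (t x y : ℝ) : ℝ := deriv (fun s => f t s y) x

/-- Partial derivative in the vertical variable of a function of (t, x, y). -/
noncomputable def dY (f : ℝ → ℝ → ℝ → ℝ) (t x y : ℝ) : ℝ := deriv (fun s => f t x s) y

/-- The function of a point of space-time corresponding to a function of (t, x, y). -/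
def uncurryTXY (f : ℝ → ℝ → ℝ → ℝ) (p : ℝ × ℝ × ℝ) : ℝ := f p.1 p.2.1 p.2.2

lemma dT_eq_fderiv {f : ℝ → ℝ → ℝ → ℝ} {q : ℝ × ℝ × ℝ}
    (hf : DifferentiableAt ℝ (uncurryTXY f) q) :
    dT f q.1 q.2.1 q.2.2 = fderiv ℝ (uncurryTXY f) q (1, 0, 0) := by
  have hline : HasDerivAt (fun s : ℝ => (s, q.2.1, q.2.2)) (1, 0, 0) q.1 :=
    (hasDerivAt_id q.1).prodMk ((hasDerivAt_const _ _).prodMk (hasDerivAt_const _ _))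
  exact (hf.hasFDerivAt.comp_hasDerivAt q.1 hline).deriv

lemma dX_eq_fderiv {f : ℝ → ℝ → ℝ → ℝ} {q : ℝ × ℝ × ℝ}
    (hf : DifferentiableAt ℝ (uncurryTXY f) q) :
    dX f q.1 q.2.1 q.2.2 = fderiv ℝ (uncurryTXY f) q (0, 1, 0) := by
  have hline : HasDerivAt (fun s : ℝ => (q.1, s, q.2.2)) (0, 1, 0) q.2.1 :=
    (hasDerivAt_const _ _).prodMk ((hasDerivAt_id _).prodMk (hasDerivAt_const _ _))
  exact (hf.hasFDerivAt.comp_hasDerivAt q.2.1 hline).deriv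

lemma dY_eq_fderiv {f : ℝ → ℝ → ℝ → ℝ} {q : ℝ × ℝ × ℝ}
    (hf : DifferentiableAt ℝ (uncurryTXY f) q) :
    dY f q.1 q.2.1 q.2.2 = fderiv ℝ (uncurryTXY f) q (0, 0, 1) := by
  have hline : HasDerivAt (fun s : ℝ => (q.1, q.2.1, s)) (0, 0, 1) q.2.2 :=
    (hasDerivAt_const _ _).prodMk ((hasDerivAt_const _ _).prodMk (hasDerivAt_id _))
  exact (hf.hasFDerivAt.comp_hasDerivAt q.2.2 hline).deriv

section DirectionalDerivatives

variable {V : Type*} [NormedAddCommGroup V] [NormedSpace ℝ V] {S : Set V} {f : V → ℝ}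

lemma differentiableAt_fderiv_apply (hS : IsOpen S) (hf : ContDiffOn ℝ 2 f S) {q : V}
    (hq : q ∈ S) (v : V) : DifferentiableAt ℝ (fun p => fderiv ℝ f p v) q :=
  (((hf.contDiffAt (hS.mem_nhds hq)).fderiv_right (m := 1) (by norm_num)).differentiableAt
    (by norm_num)).clm_apply (differentiableAt_const v)

lemma fderiv_fderiv_apply_comm (hS : IsOpen S) (hf : ContDiffOn ℝ 2 f S) {q : V}
    (hq : q ∈ S) (v w : V) :
    fderiv ℝ (fun p => fderiv ℝ f p v) q w = fderiv ℝ (fun p => fderiv ℝ f p w) q v := by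
  have hfq := hf.contDiffAt (hS.mem_nhds hq)
  have hd : DifferentiableAt ℝ (fderiv ℝ f) q :=
    (hfq.fderiv_right (m := 1) (by norm_num)).differentiableAt (by norm_num)
  have hsymm := (hfq.isSymmSndFDerivAt (by simp)).eq w v
  rw [fderiv_clm_apply hd (differentiableAt_const v), fderiv_clm_apply hd (differentiableAt_const w)]
  simpa using hsymm

lemma fderiv_eq_of_eqOn {g : V → ℝ} (hS : IsOpen S) (h : Set.EqOn f g S) {q : V} (hq : q ∈ S) :
    fderiv ℝ f q = fderiv ℝ g q :=
  (h.eventuallyEq_of_mem (hS.mem_nhds hq)).fderiv_eq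

end DirectionalDerivatives

section SecondDerivatives

variable {S : Set (ℝ × ℝ × ℝ)} {f : ℝ → ℝ → ℝ → ℝ} {q : ℝ × ℝ × ℝ}

lemma dT_dT_eq_fderiv (hS : IsOpen S) (hf : ContDiffOn ℝ 2 (uncurryTXY f) S) (hq : q ∈ S) :
    dT (dT f) q.1 q.2.1 q.2.2 =
      fderiv ℝ (fun p => fderiv ℝ (uncurryTXY f) p (1, 0, 0)) q (1, 0, 0) := by
  have h : Set.EqOn (uncurryTXY (dT f)) (fun p => fderiv ℝ (uncurryTXY f) p (1, 0, 0)) S :=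
    fun p hp => dT_eq_fderiv ((hf.contDiffAt (hS.mem_nhds hp)).differentiableAt (by norm_num))
  rw [dT_eq_fderiv ((differentiableAt_fderiv_apply hS hf hq _).congr_of_eventuallyEq
    (h.eventuallyEq_of_mem (hS.mem_nhds hq))), fderiv_eq_of_eqOn hS h hq]

lemma dX_dX_eq_fderiv (hS : IsOpen S) (hf : ContDiffOn ℝ 2 (uncurryTXY f) S) (hq : q ∈ S) :
    dX (dX f) q.1 q.2.1 q.2.2 =
      fderiv ℝ (fun p => fderiv ℝ (uncurryTXY f) p (0, 1, 0)) q (0, 1, 0) := by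
  have h : Set.EqOn (uncurryTXY (dX f)) (fun p => fderiv ℝ (uncurryTXY f) p (0, 1, 0)) S :=
    fun p hp => dX_eq_fderiv ((hf.contDiffAt (hS.mem_nhds hp)).differentiableAt (by norm_num))
  rw [dX_eq_fderiv ((differentiableAt_fderiv_apply hS hf hq _).congr_of_eventuallyEq
    (h.eventuallyEq_of_mem (hS.mem_nhds hq))), fderiv_eq_of_eqOn hS h hq]

lemma dY_dY_eq_fderiv (hS : IsOpen S) (hf : ContDiffOn ℝ 2 (uncurryTXY f) S) (hq : q ∈ S) :
    dY (dY f) q.1 q.2.1 q.2.2 =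
      fderiv ℝ (fun p => fderiv ℝ (uncurryTXY f) p (0, 0, 1)) q (0, 0, 1) := by
  have h : Set.EqOn (uncurryTXY (dY f)) (fun p => fderiv ℝ (uncurryTXY f) p (0, 0, 1)) S :=
    fun p hp => dY_eq_fderiv ((hf.contDiffAt (hS.mem_nhds hp)).differentiableAt (by norm_num))
  rw [dY_eq_fderiv ((differentiableAt_fderiv_apply hS hf hq _).congr_of_eventuallyEq
    (h.eventuallyEq_of_mem (hS.mem_nhds hq))), fderiv_eq_of_eqOn hS h hq]

end SecondDerivatives

section Induction

variable {V : Type*} [NormedAddCommGroup V] [NormedSpace ℝ V] {S : Set V}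
  {U₁ U₂ B₁ B₂ E : V → ℝ}

/-- Ampère's law with Ohm's law inserted, differentiated in a direction `v`. -/
lemma fderiv_ampere_ohm (hS : IsOpen S) {a b : ℝ} {eT eX eY : V}
    (hU₁ : ContDiffOn ℝ 2 U₁ S) (hU₂ : ContDiffOn ℝ 2 U₂ S)
    (hB₁ : ContDiffOn ℝ 2 B₁ S) (hB₂ : ContDiffOn ℝ 2 B₂ S) (hE : ContDiffOn ℝ 2 E S)
    (h : ∀ q ∈ S, a * fderiv ℝ E q eT + (E q + U₁ q * B₂ q - U₂ q * B₁ q)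
      = b * (fderiv ℝ B₂ q eX - fderiv ℝ B₁ q eY)) {q : V} (hq : q ∈ S) (v : V) :
    a * fderiv ℝ (fun p => fderiv ℝ E p eT) q v
      + (fderiv ℝ E q v + (U₁ q * fderiv ℝ B₂ q v + B₂ q * fderiv ℝ U₁ q v)
        - (U₂ q * fderiv ℝ B₁ q v + B₁ q * fderiv ℝ U₂ q v))
      = b * (fderiv ℝ (fun p => fderiv ℝ B₂ p eX) q v
        - fderiv ℝ (fun p => fderiv ℝ B₁ p eY) q v) := by
  have hdiff {f : V → ℝ} (hf : ContDiffOn ℝ 2 f S) : HasFDerivAt f (fderiv ℝ f q) q :=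
    ((hf.contDiffAt (hS.mem_nhds hq)).differentiableAt (by norm_num)).hasFDerivAt
  have hdiff' {f : V → ℝ} (hf : ContDiffOn ℝ 2 f S) (w : V) :=
    (differentiableAt_fderiv_apply hS hf hq w).hasFDerivAt
  have hl := ((hdiff' hE eT).const_mul a).add
    (((hdiff hE).add ((hdiff hU₁).mul (hdiff hB₂))).sub ((hdiff hU₂).mul (hdiff hB₁)))
  have hr := ((hdiff' hB₂ eX).sub (hdiff' hB₁ eY)).const_mul b
  have hlr := hl.unique (hr.congr_of_eventuallyEq
    (Set.EqOn.eventuallyEq_of_mem h (hS.mem_nhds hq)))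
  simpa using congrArg (fun L : V →L[ℝ] ℝ => L v) hlr

end Induction

theorem hyperbolic_induction_equation
    (σ μ₀ c T : ℝ) (hσ : 0 < σ) (hμ₀ : 0 < μ₀) (hc : 0 < c)
    (Ω : Set (ℝ × ℝ)) (hΩ : IsOpen Ω)
    (U₁ U₂ B₁ B₂ E J : ℝ → ℝ → ℝ → ℝ)
    (hU₁ : ContDiffOn ℝ 2 (fun p : ℝ × ℝ × ℝ => U₁ p.1 p.2.1 p.2.2) (Set.Ioo 0 T ×ˢ Ω))
    (hU₂ : ContDiffOn ℝ 2 (fun p : ℝ × ℝ × ℝ => U₂ p.1 p.2.1 p.2.2) (Set.Ioo 0 T ×ˢ Ω))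
    (hB₁ : ContDiffOn ℝ 2 (fun p : ℝ × ℝ × ℝ => B₁ p.1 p.2.1 p.2.2) (Set.Ioo 0 T ×ˢ Ω))
    (hB₂ : ContDiffOn ℝ 2 (fun p : ℝ × ℝ × ℝ => B₂ p.1 p.2.1 p.2.2) (Set.Ioo 0 T ×ˢ Ω))
    (hE : ContDiffOn ℝ 2 (fun p : ℝ × ℝ × ℝ => E p.1 p.2.1 p.2.2) (Set.Ioo 0 T ×ˢ Ω))
    (hJ : ContDiffOn ℝ 2 (fun p : ℝ × ℝ × ℝ => J p.1 p.2.1 p.2.2) (Set.Ioo 0 T ×ˢ Ω))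
    -- Faraday's law
    (hFaraday₁ : ∀ t ∈ Set.Ioo (0:ℝ) T, ∀ p ∈ Ω, dT B₁ t p.1 p.2 + dY E t p.1 p.2 = 0)
    (hFaraday₂ : ∀ t ∈ Set.Ioo (0:ℝ) T, ∀ p ∈ Ω, dT B₂ t p.1 p.2 - dX E t p.1 p.2 = 0)
    -- Ohm's law
    (hOhm : ∀ t ∈ Set.Ioo (0:ℝ) T, ∀ p ∈ Ω,
      J t p.1 p.2 = σ * (E t p.1 p.2 + U₁ t p.1 p.2 * B₂ t p.1 p.2 - U₂ t p.1 p.2 * B₁ t p.1 p.2))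
    -- Ampère's law
    (hAmpere : ∀ t ∈ Set.Ioo (0:ℝ) T, ∀ p ∈ Ω,
      (1 / c ^ 2) * dT E t p.1 p.2 + μ₀ * J t p.1 p.2 = dX B₂ t p.1 p.2 - dY B₁ t p.1 p.2)
    -- divergence-free conditions
    (hdivU : ∀ t ∈ Set.Ioo (0:ℝ) T, ∀ p ∈ Ω, dX U₁ t p.1 p.2 + dY U₂ t p.1 p.2 = 0)
    (hdivB : ∀ t ∈ Set.Ioo (0:ℝ) T, ∀ p ∈ Ω, dX B₁ t p.1 p.2 + dY B₂ t p.1 p.2 = 0) :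
    ∀ t ∈ Set.Ioo (0:ℝ) T, ∀ p ∈ Ω,
      ((1 / (σ * μ₀ * c ^ 2)) * dT (dT B₁) t p.1 p.2 + dT B₁ t p.1 p.2
          - (1 / (σ * μ₀)) * (dX (dX B₁) t p.1 p.2 + dY (dY B₁) t p.1 p.2)
        = B₁ t p.1 p.2 * dX U₁ t p.1 p.2 + B₂ t p.1 p.2 * dY U₁ t p.1 p.2
          - U₁ t p.1 p.2 * dX B₁ t p.1 p.2 - U₂ t p.1 p.2 * dY B₁ t p.1 p.2) ∧
      ((1 / (σ * μ₀ * c ^ 2)) * dT (dT B₂) t p.1 p.2 + dT B₂ t p.1 p.2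
          - (1 / (σ * μ₀)) * (dX (dX B₂) t p.1 p.2 + dY (dY B₂) t p.1 p.2)
        = B₁ t p.1 p.2 * dX U₂ t p.1 p.2 + B₂ t p.1 p.2 * dY U₂ t p.1 p.2
          - U₁ t p.1 p.2 * dX B₂ t p.1 p.2 - U₂ t p.1 p.2 * dY B₂ t p.1 p.2) := by
  have hS : IsOpen (Set.Ioo 0 T ×ˢ Ω) := isOpen_Ioo.prod hΩ
  change ContDiffOn ℝ 2 (uncurryTXY U₁) _ at hU₁
  change ContDiffOn ℝ 2 (uncurryTXY U₂) _ at hU₂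
  change ContDiffOn ℝ 2 (uncurryTXY B₁) _ at hB₁
  change ContDiffOn ℝ 2 (uncurryTXY B₂) _ at hB₂
  change ContDiffOn ℝ 2 (uncurryTXY E) _ at hE
  have hdiff {f : ℝ → ℝ → ℝ → ℝ} (hf : ContDiffOn ℝ 2 (uncurryTXY f) (Set.Ioo 0 T ×ˢ Ω))
      {q : ℝ × ℝ × ℝ} (hq : q ∈ Set.Ioo 0 T ×ˢ Ω) : DifferentiableAt ℝ (uncurryTXY f) q :=
    (hf.contDiffAt (hS.mem_nhds hq)).differentiableAt (by norm_num)
  have faraday₁ : Set.EqOn (fun q => fderiv ℝ (uncurryTXY B₁) q (1, 0, 0))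
      (fun q => -fderiv ℝ (uncurryTXY E) q (0, 0, 1)) (Set.Ioo 0 T ×ˢ Ω) := fun q hq => by
    have h := hFaraday₁ q.1 hq.1 q.2 hq.2
    rw [dT_eq_fderiv (hdiff hB₁ hq), dY_eq_fderiv (hdiff hE hq)] at h
    exact eq_neg_of_add_eq_zero_left h
  have faraday₂ : Set.EqOn (fun q => fderiv ℝ (uncurryTXY B₂) q (1, 0, 0))
      (fun q => fderiv ℝ (uncurryTXY E) q (0, 1, 0)) (Set.Ioo 0 T ×ˢ Ω) := fun q hq => by
    have h := hFaraday₂ q.1 hq.1 q.2 hq.2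
    rw [dT_eq_fderiv (hdiff hB₂ hq), dX_eq_fderiv (hdiff hE hq)] at h
    exact sub_eq_zero.mp h
  have divB : Set.EqOn (fun q => fderiv ℝ (uncurryTXY B₁) q (0, 1, 0))
      (fun q => -fderiv ℝ (uncurryTXY B₂) q (0, 0, 1)) (Set.Ioo 0 T ×ˢ Ω) := fun q hq => by
    have h := hdivB q.1 hq.1 q.2 hq.2
    rw [dX_eq_fderiv (hdiff hB₁ hq), dY_eq_fderiv (hdiff hB₂ hq)] at h
    exact eq_neg_of_add_eq_zero_left h
  have ampere : ∀ q ∈ Set.Ioo 0 T ×ˢ Ω,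
      (1 / (σ * μ₀ * c ^ 2)) * fderiv ℝ (uncurryTXY E) q (1, 0, 0)
        + (uncurryTXY E q + uncurryTXY U₁ q * uncurryTXY B₂ q
          - uncurryTXY U₂ q * uncurryTXY B₁ q)
        = (1 / (σ * μ₀))
          * (fderiv ℝ (uncurryTXY B₂) q (0, 1, 0) - fderiv ℝ (uncurryTXY B₁) q (0, 0, 1)) :=
    fun q hq => by
      have h := hAmpere q.1 hq.1 q.2 hq.2
      rw [hOhm q.1 hq.1 q.2 hq.2, dT_eq_fderiv (hdiff hE hq), dX_eq_fderiv (hdiff hB₂ hq),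
        dY_eq_fderiv (hdiff hB₁ hq)] at h
      rw [← h]
      simp only [uncurryTXY]
      field_simp
  intro t ht p hp
  obtain ⟨q, rfl, rfl⟩ : ∃ q : ℝ × ℝ × ℝ, q.1 = t ∧ q.2 = p := ⟨(t, p), rfl, rfl⟩
  have hq : q ∈ Set.Ioo 0 T ×ˢ Ω := ⟨ht, hp⟩
  have divU := hdivU q.1 ht q.2 hp
  rw [dX_eq_fderiv (hdiff hU₁ hq), dY_eq_fderiv (hdiff hU₂ hq)] at divU
  have ampereX := fderiv_ampere_ohm hS hU₁ hU₂ hB₁ hB₂ hE ampere hq (0, 1, 0)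
  have ampereY := fderiv_ampere_ohm hS hU₁ hU₂ hB₁ hB₂ hE ampere hq (0, 0, 1)
  rw [fderiv_fderiv_apply_comm hS hE hq] at ampereX ampereY
  rw [fderiv_fderiv_apply_comm hS hB₁ hq] at ampereX
  rw [fderiv_fderiv_apply_comm hS hB₂ hq] at ampereY
  have faradayT₁ := congrArg (fun L : ℝ × ℝ × ℝ →L[ℝ] ℝ => L (1, 0, 0))
    (fderiv_eq_of_eqOn hS faraday₁ hq)
  have faradayT₂ := congrArg (fun L : ℝ × ℝ × ℝ →L[ℝ] ℝ => L (1, 0, 0))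
    (fderiv_eq_of_eqOn hS faraday₂ hq)
  have divBX := congrArg (fun L : ℝ × ℝ × ℝ →L[ℝ] ℝ => L (0, 1, 0))
    (fderiv_eq_of_eqOn hS divB hq)
  have divBY := congrArg (fun L : ℝ × ℝ × ℝ →L[ℝ] ℝ => L (0, 0, 1))
    (fderiv_eq_of_eqOn hS divB hq)
  simp only [fderiv_fun_neg, neg_apply] at faradayT₁ faradayT₂ divBX divBY
  have hf₁ := faraday₁ hq
  have hf₂ := faraday₂ hq
  have hdB := divB hq
  simp only at hf₁ hf₂ hdB
  rw [dT_dT_eq_fderiv hS hB₁ hq, dX_dX_eq_fderiv hS hB₁ hq, dY_dY_eq_fderiv hS hB₁ hq,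
    dT_dT_eq_fderiv hS hB₂ hq, dX_dX_eq_fderiv hS hB₂ hq, dY_dY_eq_fderiv hS hB₂ hq,
    dT_eq_fderiv (hdiff hB₁ hq), dX_eq_fderiv (hdiff hB₁ hq), dY_eq_fderiv (hdiff hB₁ hq),
    dT_eq_fderiv (hdiff hB₂ hq), dX_eq_fderiv (hdiff hB₂ hq), dY_eq_fderiv (hdiff hB₂ hq),
    dX_eq_fderiv (hdiff hU₁ hq), dY_eq_fderiv (hdiff hU₁ hq),
    dX_eq_fderiv (hdiff hU₂ hq), dY_eq_fderiv (hdiff hU₂ hq)]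
  simp only [uncurryTXY] at ampereX ampereY ⊢
  constructor
  · linear_combination -ampereY + (1 / (σ * μ₀ * c ^ 2)) * faradayT₁ + hf₁
      - (1 / (σ * μ₀)) * divBX - B₁ q.1 q.2.1 q.2.2 * divU + U₁ q.1 q.2.1 q.2.2 * hdB
  · linear_combination ampereX + (1 / (σ * μ₀ * c ^ 2)) * faradayT₂ + hf₂
      - (1 / (σ * μ₀)) * divBY - B₂ q.1 q.2.1 q.2.2 * divU + U₂ q.1 q.2.1 q.2.2 * hdB
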